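/- For every even integer k ≥ 4, every integer N ≥ k², and every ε ∈ (0, 1/(2(N+k))), the Markov flow graph H_k(N,ε) admits a capacity-respecting flow from s_0 to t_1 of value (N−k)ε, and moreover (N−k)ε ≥ ((k−1)/2) · Pr[X_0 = s_0 ∧ X_N = t_1]. Hence the ratio between the maximum capacity-respecting flow from s_0 to t_1 and the probability Pr[X_0 = s_0 ∧ X_N = t_1] is at least (k−1)/2. -/

import Mathlib

open Finset

/-- A (layered) Markov flow graph: layers `L 0, …, L N` of nodes (pairwise disjoint, nonempty),
an initial distribution `p0` on `L 0`, and transition probabilities `q` supported on pairs of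
consecutive layers, with rows summing to `1`. -/
structure MarkovFlow (V : Type) [Fintype V] [DecidableEq V] where
  N : ℕ
  one_le_N : 1 ≤ N
  L : ℕ → Finset V
  layer_nonempty : ∀ l, l ≤ N → (L l).Nonempty
  layer_disjoint : ∀ l m, l ≤ N → m ≤ N → l ≠ m → Disjoint (L l) (L m)
  p0 : V → ℝ
  p0_nonneg : ∀ u, 0 ≤ p0 u
  p0_supp : ∀ u, u ∉ L 0 → p0 u = 0
  p0_sum : ∑ u ∈ L 0, p0 u = 1
  q : V → V → ℝ
  q_nonneg : ∀ u v, 0 ≤ q u v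
  q_le_one : ∀ u v, q u v ≤ 1
  q_supp : ∀ u v, q u v ≠ 0 → ∃ l, l < N ∧ u ∈ L l ∧ v ∈ L (l + 1)
  q_row : ∀ l, l < N → ∀ u ∈ L l, ∑ v ∈ L (l + 1), q u v = 1

namespace MarkovFlow

variable {V : Type} [Fintype V] [DecidableEq V]

/-- The marginal probability `p(u) = Pr[X_l = u]`. -/
noncomputable def pm (M : MarkovFlow V) : ℕ → V → ℝ
  | 0 => M.p0
  | l + 1 => fun v => ∑ u, pm M l u * M.q u v

/-- The `d`-step transition probability from node `u`. -/
noncomputable def cond (M : MarkovFlow V) (u : V) : ℕ → V → ℝ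
  | 0 => fun v => if v = u then 1 else 0
  | d + 1 => fun v => ∑ w, cond M u d w * M.q w v

/-- The joint probability `p(u,v) = Pr[X_{l₁} = u ∧ X_{l₂} = v]` (for `l₁ ≤ l₂`). -/
noncomputable def pj (M : MarkovFlow V) (l₁ l₂ : ℕ) (u v : V) : ℝ :=
  pm M l₁ u * cond M u (l₂ - l₁) v

/-- `A(v) = Pr[X_0 = s₀ ∣ X_l = v] - 1/2 = p(s₀,v)/p(v) - 1/2`. -/
noncomputable def A (M : MarkovFlow V) (s₀ : V) (l : ℕ) (v : V) : ℝ :=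
  pj M 0 l s₀ v / pm M l v - 1 / 2

/-- The potential `φ(l) = Var[A(X_l)]`. -/
noncomputable def phi (M : MarkovFlow V) (s₀ : V) (l : ℕ) : ℝ :=
  (∑ v ∈ M.L l, pm M l v * (A M s₀ l v) ^ 2) - (∑ v ∈ M.L l, pm M l v * A M s₀ l v) ^ 2

end MarkovFlow

namespace MarkovFlow

variable {V : Type} [Fintype V] [DecidableEq V]

/-- Symmetry of a Markov flow graph: an involution of the nodes preserving each layer and the
transition probabilities, swapping `s₀` with `s₁` and `t₀` with `t₁`. -/
def Symm (M : MarkovFlow V) (s₀ s₁ t₀ t₁ : V) : Prop :=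
  ∃ σ : V → V, (∀ u, σ (σ u) = u) ∧
    (∀ l, l ≤ M.N → ∀ u ∈ M.L l, σ u ∈ M.L l) ∧
    σ s₀ = s₁ ∧ σ t₀ = t₁ ∧ ∀ u v, M.q (σ u) (σ v) = M.q u v

/-- The capacity of the edge `(u,v)`, namely `p(u,v) = p(u)·q(u,v)` when `u` lies in some layer
`l < N` (and `0` otherwise). -/
noncomputable def ecap (M : MarkovFlow V) (u v : V) : ℝ :=
  ∑ l ∈ Finset.range M.N, if u ∈ M.L l then pm M l u * M.q u v else 0

/-- `g` is a capacity-respecting flow from `s₀` to `t₁` of value `F`. -/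
def IsFlow (M : MarkovFlow V) (s₀ s₁ t₀ t₁ : V) (g : V → V → ℝ) (F : ℝ) : Prop :=
  (∀ l, l < M.N → ∀ u ∈ M.L l, ∀ v ∈ M.L (l + 1),
      0 ≤ g u v ∧ g u v ≤ pm M l u * M.q u v) ∧
  (∀ v, g s₁ v = 0) ∧ (∀ u, g u t₀ = 0) ∧
  (∀ l, 0 < l → l < M.N → ∀ w ∈ M.L l,
      ∑ u ∈ M.L (l - 1), g u w = ∑ v ∈ M.L (l + 1), g w v) ∧
  ∑ v ∈ M.L 1, g s₀ v = F

/-- A set `T` of edges separates `s₀` from `t₁`: every positive-capacity layered path from `s₀`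
to `t₁` uses an edge of `T`. -/
def Separates (M : MarkovFlow V) (s₀ t₁ : V) (T : Finset (V × V)) : Prop :=
  ∀ u : ℕ → V, u 0 = s₀ → u M.N = t₁ → (∀ l, l ≤ M.N → u l ∈ M.L l) →
    (∀ l, l < M.N → 0 < pm M l (u l) * M.q (u l) (u (l + 1))) →
    ∃ l, l < M.N ∧ (u l, u (l + 1)) ∈ T

end MarkovFlow

open MarkovFlow in
/-- `M` realizes the Markov flow graph `H_k(N,ε)` of the lower-bound construction, with
sources `s₀,s₁`, sinks `t₀,t₁`, and inner-layer nodes `v j 0, …, v j (k-1)` for `0 < j < N`: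
the listed edge capacities, all other capacities `0`. -/
def IsHkGraph {V : Type} [Fintype V] [DecidableEq V] (M : MarkovFlow V)
    (k N : ℕ) (ε : ℝ) (s₀ s₁ t₀ t₁ : V) (v : ℕ → ℕ → V) : Prop :=
  M.N = N ∧
  M.L 0 = {s₀, s₁} ∧ s₀ ≠ s₁ ∧ M.p0 s₀ = 1 / 2 ∧ M.p0 s₁ = 1 / 2 ∧
  M.L N = {t₀, t₁} ∧ t₀ ≠ t₁ ∧
  (∀ j, 1 ≤ j → j ≤ N - 1 →
    M.L j = (Finset.range k).image (v j) ∧ (M.L j).card = k) ∧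
  -- first layer of edges
  (∀ i, i < k → ecap M s₀ (v 1 i) =
    (if i = 0 then 1 / 2 - ((k : ℝ) - 2) * ε
     else if i ≤ k - 2 then 2 * ε * ((k : ℝ) - 1 - (i : ℝ)) / ((k : ℝ) - 1)
     else 0)) ∧
  (∀ i, i < k → ecap M s₁ (v 1 i) =
    (if i = k - 1 then 1 / 2 - ((k : ℝ) - 2) * ε
     else if 1 ≤ i then 2 * ε * (i : ℝ) / ((k : ℝ) - 1)
     else 0)) ∧
  -- middle layers of edges
  (∀ j, 1 ≤ j → j ≤ N - 2 → ∀ a, a < k → ∀ b, b < k →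
    ecap M (v j a) (v (j + 1) b) =
      (if 1 ≤ b ∧ b ≤ k - 2 ∧ (a + 1 = b ∨ a = b + 1) then ε
       else if a = b ∧ (a = 0 ∨ a = k - 1) then 1 / 2 - ((j : ℝ) + (k : ℝ) - 2) * ε
       else if a = b ∧ (a = 1 ∨ a = k - 2) then (j : ℝ) * ε
       else 0)) ∧
  -- last layer of edges: nodes `v (N-1) i` with `i < k/2` send their full mass to `t₀`,
  -- the others send their full mass to `t₁`
  (∀ i, i < k → ecap M (v (N - 1) i) t₀ =
    (if i < k / 2 then pm M (N - 1) (v (N - 1) i) else 0)) ∧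
  (∀ i, i < k → ecap M (v (N - 1) i) t₁ =
    (if k / 2 ≤ i then pm M (N - 1) (v (N - 1) i) else 0))

namespace MarkovFlow

variable {V : Type} [Fintype V] [DecidableEq V] (M : MarkovFlow V)

lemma layer_unique {l m : ℕ} {u : V} (hl : l ≤ M.N) (hm : m ≤ M.N) (hu : u ∈ M.L l)
    (hu' : u ∈ M.L m) : l = m := by
  by_contra h
  exact Finset.disjoint_left.1 (M.layer_disjoint l m hl hm h) hu hu'

lemma pm_eq_zero {l : ℕ} (hl : l ≤ M.N) {u : V} (hu : u ∉ M.L l) : pm M l u = 0 := by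
  induction l generalizing u with
  | zero => exact M.p0_supp u hu
  | succ l ih =>
    refine Finset.sum_eq_zero fun w _ => ?_
    by_contra h
    obtain ⟨hp, hq⟩ := mul_ne_zero_iff.1 h
    obtain ⟨m, hm, hw, hu'⟩ := M.q_supp _ _ hq
    have hwl : w ∈ M.L l := by
      by_contra hw'
      exact hp (ih (by omega) hw')
    obtain rfl := M.layer_unique (by omega) (by omega) hw hwl
    exact hu hu'

lemma ecap_eq {l : ℕ} (hl : l < M.N) {u : V} (hu : u ∈ M.L l) (w : V) :
    ecap M u w = pm M l u * M.q u w := by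
  unfold ecap
  rw [Finset.sum_eq_single_of_mem l (Finset.mem_range.2 hl), if_pos hu]
  intro m hm hml
  rw [if_neg]
  intro hu'
  exact hml (M.layer_unique (by have := Finset.mem_range.1 hm; omega) hl.le hu' hu)

lemma pm_nonneg (l : ℕ) (u : V) : 0 ≤ pm M l u := by
  induction l generalizing u with
  | zero => exact M.p0_nonneg u
  | succ l ih => exact Finset.sum_nonneg fun w _ => mul_nonneg (ih w) (M.q_nonneg w u)

/-- Weighted inflow into `x` from layer `l`, expressed through the edge capacities. -/
lemma sum_weight_mul_q {l : ℕ} (hl : l < M.N) (h : V → ℝ) (x : V) :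
    ∑ u, h u * pm M l u * M.q u x = ∑ u ∈ M.L l, h u * ecap M u x := by
  symm
  rw [Finset.sum_congr rfl fun u hu => by rw [M.ecap_eq hl hu x, ← mul_assoc]]
  refine Finset.sum_subset (Finset.subset_univ _) fun u _ hu => ?_
  rw [M.pm_eq_zero hl.le hu]
  ring

lemma pm_succ {l : ℕ} (hl : l < M.N) (x : V) :
    pm M (l + 1) x = ∑ u ∈ M.L l, ecap M u x := by
  simpa [pm] using M.sum_weight_mul_q hl (fun _ => 1) x

lemma pj_zero_succ (s x : V) (l : ℕ) :
    pj M 0 (l + 1) s x = ∑ u, pj M 0 l s u * M.q u x := by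
  simp only [pj, Nat.sub_zero, MarkovFlow.cond, Finset.mul_sum, mul_assoc]

lemma ecap_eq_zero_of_notMem {l : ℕ} (hl : l < M.N) {u x : V} (hu : u ∈ M.L l)
    (hx : x ∉ M.L (l + 1)) : ecap M u x = 0 := by
  rw [M.ecap_eq hl hu]
  by_contra h
  obtain ⟨m, hm, hum, hxm⟩ := M.q_supp _ _ (mul_ne_zero_iff.1 h).2
  obtain rfl := M.layer_unique (by omega) hl.le hum hu
  exact hx hxm

end MarkovFlow

namespace HkGraph

open MarkovFlow

/-- Units of flow on the edge from index `a` in layer `j` to index `b` in layer `j + 1`: each unit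
stays at index `0`, then climbs to index `k - 2` without pausing and stays there. -/
def flow (k N j a b : ℕ) : ℕ :=
  if a = 0 ∧ b = 0 then N - k - j
  else if b = a + 1 ∧ b ≤ k - 2 then (if a < j ∧ j ≤ N - k + a then 1 else 0)
  else if a = k - 2 ∧ b = k - 2 then min (N - k) (j - (k - 2))
  else 0

/-- Units of flow through index `b` of layer `w`. -/
def through (k N w b : ℕ) : ℕ :=
  if b = 0 then N - k - (w - 1)
  else if b ≤ k - 3 then (if b < w ∧ w ≤ N - k + b then 1 else 0)
  else if b = k - 2 then min (N - k) (w - (k - 2))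
  else 0

lemma flow_eq_zero {k N j a b : ℕ} (h1 : a ≠ b) (h2 : b ≠ a + 1) : flow k N j a b = 0 := by
  rw [flow, if_neg (by omega), if_neg (by omega), if_neg (by omega)]

lemma flow_succ (k N j a : ℕ) : flow k N j a (a + 1) =
    if a + 1 ≤ k - 2 ∧ a < j ∧ j ≤ N - k + a then 1 else 0 := by
  rw [flow, if_neg (by omega)]
  split_ifs <;> omega

lemma flow_self {k : ℕ} (hk : 4 ≤ k) (N j a : ℕ) : flow k N j a a =
    if a = 0 then N - k - j else if a = k - 2 then min (N - k) (j - (k - 2)) else 0 := by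
  unfold flow
  split_ifs <;> omega

lemma sum_flow_in {k N j b : ℕ} (hk : 4 ≤ k) (hb : b < k) :
    ∑ a ∈ Finset.range k, flow k N j a b = through k N (j + 1) b := by
  rcases b with _ | b
  · rw [Finset.sum_eq_single_of_mem 0 (Finset.mem_range.2 hb)
      fun a _ ha => flow_eq_zero ha (by omega), flow_self hk]
    simp [through]
  · have h : ∀ a ∈ Finset.range k, flow k N j a (b + 1) =
        (if a = b then flow k N j b (b + 1) else 0) +
        (if a = b + 1 then flow k N j (b + 1) (b + 1) else 0) := by
      intro a _
      by_cases h1 : a = b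
      · simp [h1]
      by_cases h2 : a = b + 1
      · simp [h2]
      · rw [flow_eq_zero h2 (by omega), if_neg h1, if_neg h2]
    rw [Finset.sum_congr rfl h, Finset.sum_add_distrib, Finset.sum_ite_eq', Finset.sum_ite_eq',
      if_pos (Finset.mem_range.2 hb), if_pos (Finset.mem_range.2 (by omega)), flow_succ,
      flow_self hk, through, if_neg b.succ_ne_zero, if_neg b.succ_ne_zero]
    split_ifs <;> omega

lemma sum_flow_out {k N w b : ℕ} (hk : 4 ≤ k) (hw : 0 < w) (hb : b < k) :
    ∑ c ∈ Finset.range k, flow k N w b c = through k N w b := by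
  have h : ∀ c ∈ Finset.range k, flow k N w b c =
      (if c = b + 1 then flow k N w b (b + 1) else 0) +
      (if c = b then flow k N w b b else 0) := by
    intro c _
    by_cases h1 : c = b
    · simp [h1]
    by_cases h2 : c = b + 1
    · simp [h2]
    · rw [flow_eq_zero (Ne.symm h1) h2, if_neg h1, if_neg h2]
  rw [Finset.sum_congr rfl h, Finset.sum_add_distrib, Finset.sum_ite_eq', Finset.sum_ite_eq',
    if_pos (Finset.mem_range.2 hb), flow_succ, flow_self hk, through]
  simp only [Finset.mem_range]
  split_ifs <;> omega

/-- The capacity of the edge from index `a` in layer `j` to index `b` in layer `j + 1`. -/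
noncomputable def midCap (k : ℕ) (ε : ℝ) (j a b : ℕ) : ℝ :=
  if 1 ≤ b ∧ b ≤ k - 2 ∧ (a + 1 = b ∨ a = b + 1) then ε
  else if a = b ∧ (a = 0 ∨ a = k - 1) then 1 / 2 - ((j : ℝ) + (k : ℝ) - 2) * ε
  else if a = b ∧ (a = 1 ∨ a = k - 2) then (j : ℝ) * ε
  else 0

/-- The probability mass of index `b` in layer `l`. -/
noncomputable def mass (k : ℕ) (ε : ℝ) (l b : ℕ) : ℝ :=
  if b = 0 ∨ b = k - 1 then 1 / 2 - ((l : ℝ) + (k : ℝ) - 3) * ε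
  else if b = 1 ∨ b = k - 2 then ((l : ℝ) + 1) * ε
  else 2 * ε

lemma sum_midCap {k : ℕ} (hk : 4 ≤ k) (ε : ℝ) (j : ℕ) {b : ℕ} (hb : b < k) (h : ℕ → ℝ) :
    ∑ a ∈ Finset.range k, h a * midCap k ε j a b =
      if 1 ≤ b ∧ b ≤ k - 2 then h (b - 1) * ε + h (b + 1) * ε + h b * midCap k ε j b b
      else h b * midCap k ε j b b := by
  split_ifs with hb'
  · have e : ∀ a ∈ Finset.range k, h a * midCap k ε j a b =
        (if a = b - 1 then h (b - 1) * ε else 0) + (if a = b + 1 then h (b + 1) * ε else 0) +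
        (if a = b then h b * midCap k ε j b b else 0) := by
      intro a _
      by_cases h1 : a = b
      · subst h1
        rw [if_neg (by omega), if_neg (by omega), if_pos rfl]
        ring
      by_cases h2 : a = b - 1
      · subst h2
        rw [if_pos rfl, if_neg (by omega), if_neg h1, midCap, if_pos (by omega)]
        ring
      by_cases h3 : a = b + 1
      · subst h3
        rw [if_neg h2, if_pos rfl, if_neg h1, midCap, if_pos (by omega)]
        ring
      rw [if_neg h1, if_neg h2, if_neg h3, midCap, if_neg (by omega), if_neg (by omega),
        if_neg (by omega)]
      ring
    rw [Finset.sum_congr rfl e, Finset.sum_add_distrib, Finset.sum_add_distrib,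
      Finset.sum_ite_eq', Finset.sum_ite_eq', Finset.sum_ite_eq',
      if_pos (Finset.mem_range.2 (by omega)), if_pos (Finset.mem_range.2 (by omega)),
      if_pos (Finset.mem_range.2 hb)]
  · refine Finset.sum_eq_single_of_mem b (Finset.mem_range.2 hb) fun a _ ha => ?_
    rw [midCap, if_neg (by omega), if_neg (by omega), if_neg (by omega), mul_zero]

lemma sum_midCap_eq_mass {k : ℕ} (hk : 4 ≤ k) (ε : ℝ) (j : ℕ) {b : ℕ} (hb : b < k) :
    ∑ a ∈ Finset.range k, midCap k ε j a b = mass k ε (j + 1) b := by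
  have := sum_midCap hk ε j hb (fun _ => 1)
  simp only [one_mul] at this
  rw [this]
  unfold midCap mass
  split_ifs <;> first | omega | (push_cast; ring)

/-- The conditional probability of having started in `s₀`, given index `i`. -/
noncomputable def harm (k i : ℕ) : ℝ := 1 - (i : ℝ) / ((k : ℝ) - 1)

lemma sum_harm_mul_midCap {k : ℕ} (hk : 4 ≤ k) (ε : ℝ) (j : ℕ) {b : ℕ} (hb : b < k) :
    ∑ a ∈ Finset.range k, harm k a * midCap k ε j a b =
      harm k b * ∑ a ∈ Finset.range k, midCap k ε j a b := by
  have h1 := sum_midCap hk ε j hb (fun _ => 1)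
  simp only [one_mul] at h1
  rw [h1, sum_midCap hk ε j hb]
  split_ifs with h
  · have e : harm k (b - 1) + harm k (b + 1) = 2 * harm k b := by
      unfold harm
      push_cast [Nat.cast_sub h.1]
      ring
    linear_combination ε * e
  · rfl

lemma flow_le_midCap {k N j a b : ℕ} (hk : 4 ≤ k) (hN : k ≤ N) {ε : ℝ} (hε : 0 < ε)
    (hε1 : ((N : ℝ) + k) * ε ≤ 1 / 2) (hj : j + 1 < N) :
    ε * (flow k N j a b : ℝ) ≤ midCap k ε j a b := by
  have hjN : (j : ℝ) + 1 < N := by exact_mod_cast hj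
  have hstay : 0 ≤ 1 / 2 - ((j : ℝ) + k - 2) * ε := by nlinarith
  have hnn : 0 ≤ midCap k ε j a b := by
    unfold midCap
    split_ifs <;> positivity
  by_cases h0 : flow k N j a b = 0
  · rw [h0]; simpa using hnn
  by_cases h1 : a = 0 ∧ b = 0
  · have hf : flow k N j a b = N - k - j := by rw [flow, if_pos h1]
    have hsub : ((N - k - j : ℕ) : ℝ) = N - k - j := by
      rw [Nat.cast_sub (by omega), Nat.cast_sub hN]
    rw [hf, hsub, midCap, if_neg (by omega), if_pos (by omega)]
    nlinarith
  by_cases h2 : b = a + 1 ∧ b ≤ k - 2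
  · have hf : flow k N j a b ≤ 1 := by
      rw [flow, if_neg h1, if_pos h2]; split_ifs <;> omega
    have hf' : (flow k N j a b : ℝ) ≤ 1 := by exact_mod_cast hf
    rw [midCap, if_pos (by omega)]
    nlinarith
  by_cases h3 : a = k - 2 ∧ b = k - 2
  · have hf : flow k N j a b ≤ j := by
      rw [flow, if_neg h1, if_neg h2, if_pos h3]; omega
    have hf' : (flow k N j a b : ℝ) ≤ j := by exact_mod_cast hf
    rw [midCap, if_neg (by omega), if_neg (by omega), if_pos (by omega)]
    nlinarith
  · exact absurd (by rw [flow, if_neg h1, if_neg h2, if_neg h3]) h0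

lemma sum_harm_mul_mass_le {k N : ℕ} (hk : 4 ≤ k) (heven : Even k) (hN : k ^ 2 ≤ N) {ε : ℝ}
    (hε : 0 < ε) :
    ((k : ℝ) - 1) / 2 * ∑ i ∈ Finset.range k,
      harm k i * (if k / 2 ≤ i then mass k ε (N - 1) i else 0) ≤ ((N : ℝ) - k) * ε := by
  obtain ⟨m, hm⟩ := heven
  have hkm : k / 2 = m := by omega
  have hN1 : 1 ≤ N := by nlinarith
  have hkR : (4 : ℝ) ≤ k := by exact_mod_cast hk
  have hkmR : (k : ℝ) = m + m := by exact_mod_cast hm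
  have hNR : (k : ℝ) ^ 2 ≤ N := by exact_mod_cast hN
  have hk1 : (k : ℝ) - 1 ≠ 0 := by linarith
  have key : ∀ i ∈ Finset.range k,
      ((k : ℝ) - 1) * (harm k i * (if k / 2 ≤ i then mass k ε (N - 1) i else 0)) ≤
        (if i = k - 2 then N * ε else 0) + (if m ≤ i then k * ε else 0) := by
    intro i hi
    have hik : i < k := Finset.mem_range.1 hi
    have hh : ((k : ℝ) - 1) * harm k i = k - 1 - i := by unfold harm; field_simp
    rw [← mul_assoc, hh, hkm]
    by_cases hmi : m ≤ i
    · have hmiR : (m : ℝ) ≤ i := by exact_mod_cast hmi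
      rw [if_pos hmi, if_pos hmi]
      by_cases h1 : i = k - 1
      · have : (i : ℝ) = k - 1 := by rw [h1]; push_cast [Nat.cast_sub (by omega : 1 ≤ k)]; ring
        rw [this, if_neg (by omega)]
        simp only [sub_self, zero_mul, zero_add]
        positivity
      by_cases h2 : i = k - 2
      · have : (i : ℝ) = k - 2 := by rw [h2]; push_cast [Nat.cast_sub (by omega : 2 ≤ k)]; ring
        rw [this, if_pos h2, mass, if_neg (by omega), if_pos (by omega), Nat.cast_sub hN1]
        push_cast
        nlinarith
      · rw [if_neg h2, mass, if_neg (by omega), if_neg (by omega)]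
        nlinarith
    · rw [if_neg hmi, if_neg hmi]
      split_ifs
      · simp only [mul_zero, add_zero]; positivity
      · simp
  have hsum := Finset.sum_le_sum key
  rw [← Finset.mul_sum, Finset.sum_add_distrib, Finset.sum_ite_eq',
    if_pos (Finset.mem_range.2 (by omega))] at hsum
  have hhalf : ∑ i ∈ Finset.range k, (if m ≤ i then (k : ℝ) * ε else 0) = m * (k * ε) := by
    conv_lhs => rw [hm]
    rw [Finset.sum_range_add, Finset.sum_eq_zero, zero_add]
    · simp only [le_add_iff_nonneg_right, zero_le, if_true, Finset.sum_const, Finset.card_range,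
        nsmul_eq_mul, ← hm]
    · intro i hi
      rw [if_neg (by have := Finset.mem_range.1 hi; omega)]
  rw [hhalf] at hsum
  have hbound : (N : ℝ) + m * k ≤ 2 * (N - k) := by nlinarith
  nlinarith [mul_le_mul_of_nonneg_right hbound hε.le]

section Graph

variable {V : Type} [Fintype V] [DecidableEq V] {M : MarkovFlow V} {k N : ℕ} {ε : ℝ}
  {s₀ s₁ t₀ t₁ : V} {v : ℕ → ℕ → V}

lemma injOn_layer (hH : IsHkGraph M k N ε s₀ s₁ t₀ t₁ v) {j : ℕ} (h1 : 1 ≤ j) (h2 : j ≤ N - 1) :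
    Set.InjOn (v j) (Finset.range k) := by
  obtain ⟨-, -, -, -, -, -, -, hL, -⟩ := hH
  obtain ⟨he, hc⟩ := hL j h1 h2
  rw [he] at hc
  exact Finset.card_image_iff.1 (by rw [hc, Finset.card_range])

lemma sum_layer (hH : IsHkGraph M k N ε s₀ s₁ t₀ t₁ v) {j : ℕ} (h1 : 1 ≤ j) (h2 : j ≤ N - 1)
    {R : Type} [AddCommMonoid R] (F : V → R) :
    ∑ u ∈ M.L j, F u = ∑ i ∈ Finset.range k, F (v j i) := by
  have hinj := injOn_layer hH h1 h2
  obtain ⟨-, -, -, -, -, -, -, hL, -⟩ := hH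
  rw [(hL j h1 h2).1, Finset.sum_image hinj]

lemma mem_layer (hH : IsHkGraph M k N ε s₀ s₁ t₀ t₁ v) {j : ℕ} (h1 : 1 ≤ j) (h2 : j ≤ N - 1)
    {u : V} : u ∈ M.L j ↔ ∃ i < k, v j i = u := by
  obtain ⟨-, -, -, -, -, -, -, hL, -⟩ := hH
  rw [(hL j h1 h2).1]
  simp

lemma exists_level (M : MarkovFlow V) :
    ∃ lev : V → ℕ, ∀ l ≤ M.N, ∀ u ∈ M.L l, lev u = l := by
  classical
  refine ⟨fun u => if h : ∃ l ≤ M.N, u ∈ M.L l then h.choose else 0, fun l hl u hu => ?_⟩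
  have h : ∃ l ≤ M.N, u ∈ M.L l := ⟨l, hl, hu⟩
  simp only [dif_pos h]
  exact M.layer_unique h.choose_spec.1 hl h.choose_spec.2 hu

lemma exists_index (hH : IsHkGraph M k N ε s₀ s₁ t₀ t₁ v) :
    ∃ idx : V → ℕ, (∀ j, 1 ≤ j → j ≤ N - 1 → ∀ i < k, idx (v j i) = i) ∧
      idx s₀ = 0 ∧ idx s₁ = k - 1 ∧ idx t₀ = k - 1 ∧ idx t₁ = k - 2 := by
  classical
  obtain ⟨lev, hlev⟩ := exists_level M
  have hinj := fun j h1 h2 => injOn_layer hH (j := j) h1 h2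
  have hmem := fun j h1 h2 i (hi : i < k) =>
    (mem_layer hH (j := j) h1 h2 (u := v j i)).2 ⟨i, hi, rfl⟩
  obtain ⟨rfl, h0, hs, -, -, hN, ht, -⟩ := hH
  have hN1 := M.one_le_N
  have ls₀ : lev s₀ = 0 := hlev 0 (by omega) _ (by simp [h0])
  have ls₁ : lev s₁ = 0 := hlev 0 (by omega) _ (by simp [h0])
  have lt₀ : lev t₀ = M.N := hlev _ le_rfl _ (by simp [hN])
  have lt₁ : lev t₁ = M.N := hlev _ le_rfl _ (by simp [hN])
  refine ⟨fun u => if u = s₀ then 0 else if u = s₁ then k - 1 else if u = t₀ then k - 1 else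
    if u = t₁ then k - 2 else
      if h : ∃ i < k, v (lev u) i = u then h.choose else 0, ?_, ?_, ?_, ?_, ?_⟩
  · intro j h1 h2 i hi
    have hl : lev (v j i) = j := hlev j (by omega) _ (hmem j h1 h2 i hi)
    have hne : ∀ x, lev x ≠ j → v j i ≠ x := by
      rintro x hx rfl
      exact hx hl
    have h : ∃ i' < k, v (lev (v j i)) i' = v j i := ⟨i, hi, by rw [hl]⟩
    simp only [if_neg (hne s₀ (by omega)), if_neg (hne s₁ (by omega)), if_neg (hne t₀ (by omega)),
      if_neg (hne t₁ (by omega)), dif_pos h]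
    obtain ⟨hc1, hc2⟩ := h.choose_spec
    have hc3 : v j h.choose = v j i := by
      generalize h.choose = c at hc2
      rwa [hl] at hc2
    exact hinj j h1 h2 (by simpa using hc1) (by simpa using hi) hc3
  · simp
  · simp [hs.symm]
  · have a : t₀ ≠ s₀ := by rintro rfl; omega
    have b : t₀ ≠ s₁ := by rintro rfl; omega
    simp [a, b]
  · have a : t₁ ≠ s₀ := by rintro rfl; omega
    have b : t₁ ≠ s₁ := by rintro rfl; omega
    simp [a, b, ht.symm]

lemma ecap_mid (hH : IsHkGraph M k N ε s₀ s₁ t₀ t₁ v) {j a b : ℕ} (h1 : 1 ≤ j) (h2 : j ≤ N - 2)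
    (ha : a < k) (hb : b < k) : ecap M (v j a) (v (j + 1) b) = midCap k ε j a b := by
  obtain ⟨-, -, -, -, -, -, -, -, -, -, h, -⟩ := hH
  rw [h j h1 h2 a ha b hb, midCap]

lemma ecap_s₀ (hH : IsHkGraph M k N ε s₀ s₁ t₀ t₁ v) (hk : 4 ≤ k) {i : ℕ} (hi : i < k) :
    ecap M s₀ (v 1 i) = harm k i * mass k ε 1 i := by
  obtain ⟨-, -, -, -, -, -, -, -, h, -⟩ := hH
  have hkR : (4 : ℝ) ≤ k := by exact_mod_cast hk
  have hk1 : (k : ℝ) - 1 ≠ 0 := by linarith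
  rw [h i hi]
  unfold harm mass
  by_cases a : i = 0
  · rw [if_pos a, if_pos (Or.inl a), a]; push_cast; ring
  by_cases b : i = k - 1
  · have : (i : ℝ) = k - 1 := by
      rw [b]; push_cast [Nat.cast_sub (by omega : 1 ≤ k)]; ring
    rw [if_neg a, if_neg (by omega), this, div_self hk1, sub_self, zero_mul]
  rw [if_neg a, if_pos (by omega), if_neg (by omega)]
  split_ifs <;> (push_cast; field_simp; try ring)

lemma ecap_s₁ (hH : IsHkGraph M k N ε s₀ s₁ t₀ t₁ v) (hk : 4 ≤ k) {i : ℕ} (hi : i < k) :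
    ecap M s₁ (v 1 i) = (1 - harm k i) * mass k ε 1 i := by
  obtain ⟨-, -, -, -, -, -, -, -, -, h, -⟩ := hH
  have hkR : (4 : ℝ) ≤ k := by exact_mod_cast hk
  have hk1 : (k : ℝ) - 1 ≠ 0 := by linarith
  rw [h i hi]
  unfold harm mass
  by_cases a : i = k - 1
  · have : (i : ℝ) = k - 1 := by
      rw [a]; push_cast [Nat.cast_sub (by omega : 1 ≤ k)]; ring
    rw [if_pos a, if_pos (Or.inr a), this, div_self hk1]; push_cast; ring
  by_cases b : i = 0
  · rw [if_neg a, if_neg (by omega), b]; simp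
  rw [if_neg a, if_pos (by omega), if_neg (by omega)]
  split_ifs <;> (push_cast; field_simp; try ring)

lemma pm_layer (hH : IsHkGraph M k N ε s₀ s₁ t₀ t₁ v) (hk : 4 ≤ k) (hN : k < N) {l i : ℕ}
    (h1 : 1 ≤ l) (h2 : l ≤ N - 1) (hi : i < k) : pm M l (v l i) = mass k ε l i := by
  obtain ⟨hMN, h0, hs, -⟩ := id hH
  obtain ⟨l, rfl⟩ := Nat.exists_eq_add_of_le' h1
  rw [M.pm_succ (by omega)]
  rcases Nat.eq_zero_or_pos l with rfl | hl
  · rw [h0, Finset.sum_pair hs, ecap_s₀ hH hk hi, ecap_s₁ hH hk hi]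
    ring
  · rw [sum_layer hH hl (by omega), ← sum_midCap_eq_mass hk ε l hi]
    exact Finset.sum_congr rfl fun a ha =>
      ecap_mid hH hl (by omega) (Finset.mem_range.1 ha) hi

/-- The conditional probability of having started in `s₀` depends only on the index. -/
lemma pj_zero_eq (hH : IsHkGraph M k N ε s₀ s₁ t₀ t₁ v) (hk : 4 ≤ k) (hN : k < N)
    {idx : V → ℕ} (hidx : ∀ j, 1 ≤ j → j ≤ N - 1 → ∀ i < k, idx (v j i) = i)
    (hs₀ : idx s₀ = 0) (hs₁ : idx s₁ = k - 1) {l : ℕ} (hl : l ≤ N - 1) (u : V) :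
    pj M 0 l s₀ u = harm k (idx u) * pm M l u := by
  obtain ⟨hMN, h0, hs, -⟩ := id hH
  have hkR : (4 : ℝ) ≤ k := by exact_mod_cast hk
  have hk1 : (k : ℝ) - 1 ≠ 0 := by linarith
  have hz : harm k (k - 1) = 0 := by
    unfold harm
    push_cast [Nat.cast_sub (by omega : 1 ≤ k)]
    field_simp; ring
  have hone : harm k 0 = 1 := by simp [harm]
  induction l generalizing u with
  | zero =>
    simp only [pj, Nat.sub_zero, MarkovFlow.cond, pm]
    by_cases a : u = s₀
    · subst a; rw [hs₀, hone, if_pos rfl]; ring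
    rw [if_neg a]
    by_cases b : u = s₁
    · subst b; rw [hs₁, hz]; ring
    · rw [M.p0_supp u (by simp [h0, a, b])]; ring
  | succ l ih =>
    have hlN : l < M.N := by omega
    rw [M.pj_zero_succ, M.pm_succ hlN]
    simp only [ih (by omega)]
    rw [M.sum_weight_mul_q hlN (fun u => harm k (idx u))]
    by_cases hu : u ∈ M.L (l + 1)
    · obtain ⟨i, hi, rfl⟩ := (mem_layer hH (by omega) hl).1 hu
      rw [hidx _ (by omega) hl i hi]
      rcases Nat.eq_zero_or_pos l with rfl | hl0
      · rw [h0, Finset.sum_pair hs, Finset.sum_pair hs, ecap_s₀ hH hk hi, ecap_s₁ hH hk hi,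
          hs₀, hs₁, hz, hone]
        ring
      · rw [sum_layer hH hl0 (by omega), sum_layer hH hl0 (by omega)]
        have e : ∀ a ∈ Finset.range k, ecap M (v l a) (v (l + 1) i) = midCap k ε l a i :=
          fun a ha => ecap_mid hH hl0 (by omega) (Finset.mem_range.1 ha) hi
        rw [Finset.sum_congr rfl e, ← sum_harm_mul_midCap hk ε l hi]
        refine Finset.sum_congr rfl fun a ha => ?_
        rw [e a ha, hidx l hl0 (by omega) a (Finset.mem_range.1 ha)]
    · rw [Finset.sum_eq_zero fun w hw => by rw [M.ecap_eq_zero_of_notMem hlN hw hu, mul_zero],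
        Finset.sum_eq_zero fun w hw => M.ecap_eq_zero_of_notMem hlN hw hu, mul_zero]

lemma pj_s₀_t₁ (hH : IsHkGraph M k N ε s₀ s₁ t₀ t₁ v) (hk : 4 ≤ k) (hN : k < N) :
    pj M 0 N s₀ t₁ = ∑ i ∈ Finset.range k,
      harm k i * (if k / 2 ≤ i then mass k ε (N - 1) i else 0) := by
  obtain ⟨idx, hidx, hs₀, hs₁, -⟩ := exists_index hH
  obtain ⟨hMN, -, -, -, -, -, -, -, -, -, -, -, hlast⟩ := id hH
  have e := M.pj_zero_succ s₀ t₁ (N - 1)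
  rw [Nat.sub_add_cancel (by omega)] at e
  rw [e]
  simp only [pj_zero_eq hH hk hN hidx hs₀ hs₁ le_rfl]
  rw [M.sum_weight_mul_q (by omega) (fun u => harm k (idx u)),
    sum_layer hH (by omega) le_rfl]
  refine Finset.sum_congr rfl fun i hi => ?_
  have hik := Finset.mem_range.1 hi
  rw [hidx _ (by omega) le_rfl i hik, hlast i hik, pm_layer hH hk hN (by omega) le_rfl hik]

lemma flow_top (k N j a : ℕ) (hk : 4 ≤ k) : flow k N j a (k - 1) = 0 := by
  unfold flow
  split_ifs <;> omega

lemma flow_bot (k N j b : ℕ) (hk : 4 ≤ k) : flow k N j (k - 1) b = 0 := by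
  unfold flow
  split_ifs <;> omega

lemma flow_first (k N b : ℕ) (hk : 4 ≤ k) :
    flow k N 0 0 b = if b = 0 then N - k else 0 := by
  unfold flow
  split_ifs <;> omega

lemma flow_last {k N a : ℕ} (hk : 4 ≤ k) (hN : k < N) :
    flow k N (N - 1) a (k - 2) = if a = k - 2 then N - k else 0 := by
  unfold flow
  split_ifs <;> omega

lemma through_last {k N a : ℕ} (hk : 4 ≤ k) (hN : k < N) :
    through k N (N - 1) a = if a = k - 2 then N - k else 0 := by
  unfold through
  split_ifs <;> omega

lemma through_one {k N a : ℕ} (hk : 4 ≤ k) (hN : k < N) :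
    through k N 1 a = if a = 0 then N - k else 0 := by
  unfold through
  split_ifs <;> omega

lemma exists_isFlow (hH : IsHkGraph M k N ε s₀ s₁ t₀ t₁ v) (hk : 4 ≤ k) (hN : k < N)
    (hε : 0 < ε) (hε1 : ((N : ℝ) + k) * ε ≤ 1 / 2) :
    ∃ g : V → V → ℝ, M.IsFlow s₀ s₁ t₀ t₁ g (((N : ℝ) - (k : ℝ)) * ε) := by
  obtain ⟨idx, hidx, hs₀, hs₁, ht₀, ht₁⟩ := exists_index hH
  obtain ⟨lev, hlev⟩ := exists_level M
  obtain ⟨hMN, h0, hs, -, -, hLN, ht, -, -, -, -, -, hlast⟩ := id hH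
  have hkR : (4 : ℝ) ≤ k := by exact_mod_cast hk
  have hNR : (k : ℝ) < N := by exact_mod_cast hN
  have hNk : ((N - k : ℕ) : ℝ) = N - k := Nat.cast_sub hN.le
  have hone : harm k 0 = 1 := by simp [harm]
  refine ⟨fun u w => ε * (flow k N (lev u) (idx u) (idx w) : ℝ), ?_, ?_, ?_, ?_, ?_⟩
  · intro l hl u hu w hw
    beta_reduce
    refine ⟨by positivity, ?_⟩
    have hpos := mul_nonneg (M.pm_nonneg l u) (M.q_nonneg u w)
    rw [← M.ecap_eq hl hu] at hpos ⊢
    rw [hlev l hl.le u hu]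
    rcases Nat.eq_zero_or_pos l with rfl | hl0
    · rw [h0, Finset.mem_insert, Finset.mem_singleton] at hu
      rcases hu with rfl | rfl
      · obtain ⟨b, hb, rfl⟩ := (mem_layer hH le_rfl (by omega)).1 hw
        rw [hs₀, hidx 1 le_rfl (by omega) b hb, flow_first k N b hk]
        split_ifs with hb0
        · subst hb0
          rw [ecap_s₀ hH hk hb, hone, mass, if_pos (Or.inl rfl), hNk]
          push_cast
          nlinarith
        · simpa using hpos
      · simpa [hs₁, flow_bot k N _ _ hk] using hpos
    obtain ⟨a, ha, rfl⟩ := (mem_layer hH hl0 (by omega)).1 hu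
    rw [hidx l hl0 (by omega) a ha]
    by_cases hlN : l + 1 = N
    · rw [hlN, hLN, Finset.mem_insert, Finset.mem_singleton] at hw
      rcases hw with rfl | rfl
      · simpa [ht₀, flow_top k N _ _ hk] using hpos
      · obtain rfl : l = N - 1 := by omega
        rw [ht₁, flow_last hk hN]
        split_ifs with hak
        · rw [hlast a ha, if_pos (by omega), pm_layer hH hk hN hl0 le_rfl ha, mass,
            if_neg (by omega), if_pos (Or.inr hak), hNk, Nat.cast_sub (by omega)]
          push_cast
          nlinarith
        · simpa using hpos
    · obtain ⟨b, hb, rfl⟩ := (mem_layer hH (by omega) (by omega)).1 hw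
      rw [hidx _ (by omega) (by omega) b hb, ecap_mid hH hl0 (by omega) ha hb]
      exact flow_le_midCap hk hN.le hε hε1 (by omega)
  · intro w
    simp [hs₁, flow_bot k N _ _ hk]
  · intro u
    simp [ht₀, flow_top k N _ _ hk]
  · intro l hl0 hl w hw
    obtain ⟨b, hb, rfl⟩ := (mem_layer hH hl0 (by omega)).1 hw
    have hin : ∑ u ∈ M.L (l - 1), flow k N (lev u) (idx u) (idx (v l b)) = through k N l b := by
      rw [Finset.sum_congr rfl fun u hu => by rw [hlev (l - 1) (by omega) u hu],
        hidx l hl0 (by omega) b hb]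
      obtain ⟨j, rfl⟩ := Nat.exists_eq_add_of_le' hl0
      rw [Nat.add_sub_cancel]
      rcases Nat.eq_zero_or_pos j with rfl | hj
      · rw [h0, Finset.sum_pair hs, hs₀, hs₁, flow_bot k N _ _ hk, flow_first k N b hk,
          through_one hk hN, add_zero]
      · rw [sum_layer hH hj (by omega), ← sum_flow_in hk hb]
        exact Finset.sum_congr rfl fun a ha => by
          rw [hidx j hj (by omega) a (Finset.mem_range.1 ha)]
    have hout : ∑ x ∈ M.L (l + 1), flow k N (lev (v l b)) (idx (v l b)) (idx x) =
        through k N l b := by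
      rw [hlev l hl.le _ hw, hidx l hl0 (by omega) b hb]
      by_cases hlN : l + 1 = N
      · obtain rfl : l = N - 1 := by omega
        rw [hlN, hLN, Finset.sum_pair ht, ht₀, ht₁, flow_top k N _ _ hk, flow_last hk hN,
          through_last hk hN, zero_add]
      · rw [sum_layer hH (by omega) (by omega), ← sum_flow_out hk hl0 hb]
        exact Finset.sum_congr rfl fun c hc => by
          rw [hidx (l + 1) (by omega) (by omega) c (Finset.mem_range.1 hc)]
    rw [← Finset.mul_sum, ← Finset.mul_sum, ← Nat.cast_sum, ← Nat.cast_sum, hin, hout]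
  · rw [← Finset.mul_sum, ← Nat.cast_sum, sum_layer hH le_rfl (by omega),
      hlev 0 (by omega) s₀ (by simp [h0]), hs₀]
    have e : ∀ i ∈ Finset.range k, flow k N 0 0 (idx (v 1 i)) = if i = 0 then N - k else 0 := by
      intro i hi
      rw [hidx 1 le_rfl (by omega) i (Finset.mem_range.1 hi), flow_first k N i hk]
    rw [Finset.sum_congr rfl e, Finset.sum_ite_eq', if_pos (Finset.mem_range.2 (by omega)), hNk,
      mul_comm]

end Graph

end HkGraph

/-- Section 6 of the paper, the lower bound for the rounding algorithm: for
`N ≥ k²`, the graph `H_k(N,ε)` admits a capacity-respecting flow from `s₀` to `t₁` of value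
`(N−k)ε`, and moreover `(N−k)ε ≥ ((k−1)/2)·Pr[X_0 = s₀ ∧ X_N = t₁]`; hence the ratio between
the maximum capacity-respecting `s₀`–`t₁` flow and this probability is at least `(k−1)/2`. -/
theorem stmt16 (k N : ℕ) (ε : ℝ) (hk4 : 4 ≤ k) (hkeven : Even k) (hkN : k ^ 2 ≤ N)
    (hε0 : 0 < ε) (hε1 : ε < 1 / (2 * ((N : ℝ) + (k : ℝ))))
    (V : Type) [Fintype V] [DecidableEq V]
    (M : MarkovFlow V) (s₀ s₁ t₀ t₁ : V) (v : ℕ → ℕ → V)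
    (hH : IsHkGraph M k N ε s₀ s₁ t₀ t₁ v) :
    (∃ g : V → V → ℝ, M.IsFlow s₀ s₁ t₀ t₁ g (((N : ℝ) - (k : ℝ)) * ε)) ∧
    ((k : ℝ) - 1) / 2 * MarkovFlow.pj M 0 N s₀ t₁ ≤ ((N : ℝ) - (k : ℝ)) * ε := by
  have hkN' : k < N := by nlinarith
  have hkR : (4 : ℝ) ≤ k := by exact_mod_cast hk4
  have hNR : (0 : ℝ) ≤ N := Nat.cast_nonneg N
  have hcap : ((N : ℝ) + k) * ε ≤ 1 / 2 := by
    have := (lt_div_iff₀ (by positivity)).1 hε1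
    linarith
  refine ⟨HkGraph.exists_isFlow hH hk4 hkN' hε0 hcap, ?_⟩
  rw [HkGraph.pj_s₀_t₁ hH hk4 hkN']
  exact HkGraph.sum_harm_mul_mass_le hk4 hkeven hkN hε0
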